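/- Let {Φ_n} be a sequence of quantum channels from A to B converging strongly to a channel Φ₀, with Ch(Φ_n) ≤ m for all n, and let Φ_n(ρ) = Σ_{i=1}^m A_i^n ρ (A_i^n)* be a Kraus representation of Φ_n for each n. Then there exist operators A_1^0, …, A_m^0 ∈ B(H_A, H_B) and a strictly increasing sequence {n_k} of natural numbers such that A_i^{n_k} → A_i^0 in the strong operator topology for every i = 1, …, m, and Φ₀(ρ) = Σ_{i=1}^m A_i^0 ρ (A_i^0)* for all ρ ∈ T(H_A). -/

import Mathlib

open Filter Topology ContinuousLinearMap
open scoped ComplexOrder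

noncomputable section

notation "⟪" x ", " y "⟫" => @inner ℂ _ _ x y

section Defs

variable {H K : Type*} [NormedAddCommGroup H] [InnerProductSpace ℂ H] [CompleteSpace H]
  [NormedAddCommGroup K] [InnerProductSpace ℂ K] [CompleteSpace K]

/-- The rank-one operator `|y⟩⟨z|`. -/
def rankOne (y : K) (z : H) : H →L[ℂ] K :=
  (ContinuousLinearMap.toSpanSingleton ℂ y).comp (innerSL ℂ z)

/-- `A` is a trace-class operator (equivalently, nuclear operator). -/
def IsTC (A : H →L[ℂ] K) : Prop :=
  ∃ f : ℕ → K, ∃ g : ℕ → H, Summable (fun n => ‖f n‖ * ‖g n‖) ∧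
    ∀ x : H, HasSum (fun n => ⟪g n, x⟫ • f n) (A x)

/-- The trace of an operator, computed in a Hilbert basis. -/
def trC {ι : Type*} (e : HilbertBasis ι ℂ H) (A : H →L[ℂ] H) : ℂ :=
  ∑' i, ⟪e i, A (e i)⟫

/-- The trace norm `‖A‖₁ = sup {|Tr (B A)| : ‖B‖ ≤ 1}`. -/
def tnorm {ι : Type*} (e : HilbertBasis ι ℂ H) (A : H →L[ℂ] H) : ℝ :=
  sSup { r : ℝ | ∃ B : H →L[ℂ] H, ‖B‖ ≤ 1 ∧ r = ‖trC e (B ∘L A)‖ }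

/-- Membership in the positive cone `T₊(H)` of trace-class operators. -/
def IsPTC (ρ : H →L[ℂ] H) : Prop := ρ.IsPositive ∧ IsTC ρ

/-- `ρ` is a state (a positive trace-class operator of unit trace). -/
def IsState {ι : Type*} (e : HilbertBasis ι ℂ H) (ρ : H →L[ℂ] H) : Prop :=
  ρ.IsPositive ∧ IsTC ρ ∧ trC e ρ = 1

/-- `ρ` is a faithful state (a state with trivial kernel). -/
def IsFaithfulState {ι : Type*} (e : HilbertBasis ι ℂ H) (ρ : H →L[ℂ] H) : Prop :=
  IsState e ρ ∧ ∀ x, ρ x = 0 → x = 0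

/-- The Loewner operator order. -/
def OpLE (A B : H →L[ℂ] H) : Prop := (B - A).IsPositive

/-- `S` is the least upper bound of the sequence `A` in the Loewner order. -/
def IsLUBOp (A : ℕ → H →L[ℂ] H) (S : H →L[ℂ] H) : Prop :=
  (∀ m, OpLE (A m) S) ∧ ∀ C, (∀ m, OpLE (A m) C) → OpLE S C

/-- A quantum operation from `A` to `B`: a completely positive trace-non-increasing
linear map from `T(H_A)` to `T(H_B)`. -/
structure QOp (eA : HilbertBasis ℕ ℂ H) (eB : HilbertBasis ℕ ℂ K) where
  toFun : (H →L[ℂ] H) → (K →L[ℂ] K)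
  map_add' : ∀ ρ σ : H →L[ℂ] H, IsTC ρ → IsTC σ → toFun (ρ + σ) = toFun ρ + toFun σ
  map_smul' : ∀ (c : ℂ) (ρ : H →L[ℂ] H), IsTC ρ → toFun (c • ρ) = c • toFun ρ
  maps_tc' : ∀ ρ : H →L[ℂ] H, IsTC ρ → IsTC (toFun ρ)
  completely_pos' : ∀ (n : ℕ) (y : Fin n → H) (x : Fin n → K),
    0 ≤ ∑ i, ∑ j, ⟪x i, toFun (rankOne (y i) (y j)) (x j)⟫
  trace_nonincreasing' : ∀ ρ : H →L[ℂ] H, ρ.IsPositive → IsTC ρ →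
    (trC eB (toFun ρ)).re ≤ (trC eA ρ).re

variable {eA : HilbertBasis ℕ ℂ H} {eB : HilbertBasis ℕ ℂ K}

/-- A quantum channel is a trace-preserving quantum operation. -/
def IsChannel (Φ : QOp eA eB) : Prop :=
  ∀ ρ : H →L[ℂ] H, ρ.IsPositive → IsTC ρ → trC eB (Φ.toFun ρ) = trC eA ρ

/-- Convergence in the trace norm. -/
def TNConv {ι : Type*} (e : HilbertBasis ι ℂ K) (a : ℕ → K →L[ℂ] K) (L : K →L[ℂ] K) : Prop :=
  Tendsto (fun n => tnorm e (a n - L)) atTop (nhds 0)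

/-- Strong convergence of a sequence of quantum operations. -/
def StrongConv (Φn : ℕ → QOp eA eB) (Φ : QOp eA eB) : Prop :=
  ∀ ρ : H →L[ℂ] H, IsState eA ρ → TNConv eB (fun n => (Φn n).toFun ρ) (Φ.toFun ρ)

/-- Relative (sequential) compactness in the strong convergence topology. -/
def QRelCompact (F : Set (QOp eA eB)) : Prop :=
  ∀ Φs : ℕ → QOp eA eB, (∀ n, Φs n ∈ F) →
    ∃ (k : ℕ → ℕ) (Φ₀ : QOp eA eB), StrictMono k ∧ StrongConv (fun n => Φs (k n)) Φ₀

/-- Relative (sequential) compactness within the set of quantum channels. -/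
def QRelCompactCh (F : Set (QOp eA eB)) : Prop :=
  ∀ Φs : ℕ → QOp eA eB, (∀ n, Φs n ∈ F) →
    ∃ (k : ℕ → ℕ) (Φ₀ : QOp eA eB), StrictMono k ∧ IsChannel Φ₀ ∧
      StrongConv (fun n => Φs (k n)) Φ₀

/-- (Sequential) compactness in the strong convergence topology. -/
def QSeqCompact (F : Set (QOp eA eB)) : Prop :=
  ∀ Φs : ℕ → QOp eA eB, (∀ n, Φs n ∈ F) →
    ∃ (k : ℕ → ℕ) (Φ₀ : QOp eA eB), StrictMono k ∧ Φ₀ ∈ F ∧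
      StrongConv (fun n => Φs (k n)) Φ₀

/-- (Sequential) closedness in the strong convergence topology. -/
def QSeqClosed (F : Set (QOp eA eB)) : Prop :=
  ∀ (Φs : ℕ → QOp eA eB) (Φ₀ : QOp eA eB), (∀ n, Φs n ∈ F) → StrongConv Φs Φ₀ → Φ₀ ∈ F

/-- (Sequential) compactness of a set of operators in the trace norm. -/
def TNSeqCompact {ι : Type*} (e : HilbertBasis ι ℂ K) (S : Set (K →L[ℂ] K)) : Prop :=
  ∀ a : ℕ → K →L[ℂ] K, (∀ n, a n ∈ S) →
    ∃ (k : ℕ → ℕ) (L : K →L[ℂ] K), StrictMono k ∧ L ∈ S ∧ TNConv e (fun n => a (k n)) L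

/-- Relative (sequential) compactness of `S` within the ambient set `T`, in the trace norm. -/
def TNRelCompactIn {ι : Type*} (e : HilbertBasis ι ℂ K) (T S : Set (K →L[ℂ] K)) : Prop :=
  ∀ a : ℕ → K →L[ℂ] K, (∀ n, a n ∈ S) →
    ∃ (k : ℕ → ℕ) (L : K →L[ℂ] K), StrictMono k ∧ L ∈ T ∧ TNConv e (fun n => a (k n)) L

/-- `A` is a Kraus representation of `Φ`. -/
def KrausRep (Φ : QOp eA eB) (A : ℕ → H →L[ℂ] K) : Prop :=
  ∀ ρ : H →L[ℂ] H, IsTC ρ →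
    HasSum (fun n => A n ∘L ρ ∘L (ContinuousLinearMap.adjoint (A n))) (Φ.toFun ρ)

/-- The Choi rank of a quantum operation: the minimal number of Kraus operators. -/
def ChoiRank (Φ : QOp eA eB) : ℕ∞ :=
  sInf { n : ℕ∞ | ∃ A : ℕ → H →L[ℂ] K, (∀ i : ℕ, n ≤ (i : ℕ∞) → A i = 0) ∧ KrausRep Φ A }

/-- Convergence in the strong operator topology. -/
def SOTConv (a : ℕ → H →L[ℂ] K) (A : H →L[ℂ] K) : Prop :=
  ∀ x : H, Tendsto (fun n => a n x) atTop (nhds (A x))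

/-- Relative (sequential) compactness in the strong operator topology. -/
def SOTRelCompact (S : Set (H →L[ℂ] K)) : Prop :=
  ∀ a : ℕ → H →L[ℂ] K, (∀ n, a n ∈ S) →
    ∃ (k : ℕ → ℕ) (A : H →L[ℂ] K), StrictMono k ∧ SOTConv (fun n => a (k n)) A

/-- (Sequential) compactness in the strong operator topology. -/
def SOTSeqCompact (S : Set (H →L[ℂ] K)) : Prop :=
  ∀ a : ℕ → H →L[ℂ] K, (∀ n, a n ∈ S) →
    ∃ (k : ℕ → ℕ) (A : H →L[ℂ] K), StrictMono k ∧ A ∈ S ∧ SOTConv (fun n => a (k n)) A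

/-- A finite-rank orthogonal projection. -/
def IsFinRankProj (P : K →L[ℂ] K) : Prop :=
  IsSelfAdjoint P ∧ P ∘L P = P ∧ FiniteDimensional ℂ (LinearMap.range (P : K →ₗ[ℂ] K))

end Defs

section Tensor

variable {H K W : Type*} [NormedAddCommGroup H] [InnerProductSpace ℂ H] [CompleteSpace H]
  [NormedAddCommGroup K] [InnerProductSpace ℂ K] [CompleteSpace K]
  [NormedAddCommGroup W] [InnerProductSpace ℂ W] [CompleteSpace W]

/-- A realization of `W` as the Hilbert tensor product `H ⊗ K`. -/
structure TensorStruct (H K W : Type*) [NormedAddCommGroup H] [InnerProductSpace ℂ H]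
    [NormedAddCommGroup K] [InnerProductSpace ℂ K]
    [NormedAddCommGroup W] [InnerProductSpace ℂ W] where
  mul : H → K → W
  inner_mul : ∀ (x x' : H) (y y' : K), ⟪mul x y, mul x' y'⟫ = ⟪x, x'⟫ * ⟪y, y'⟫
  dense_span : Dense (↑(Submodule.span ℂ {w : W | ∃ x y, w = mul x y}) : Set W)

/-- `Z = X ⊗ Y` relative to the tensor realization `T`. -/
def IsTensorOp (T : TensorStruct H K W) (X : H →L[ℂ] H) (Y : K →L[ℂ] K)
    (Z : W →L[ℂ] W) : Prop :=
  ∀ x y, Z (T.mul x y) = T.mul (X x) (Y y)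

/-- `b = Tr_K ω`, the left partial trace, characterized by duality. -/
def IsLeftMarginal (T : TensorStruct H K W) {ι κ : Type*} (eH : HilbertBasis ι ℂ H)
    (eW : HilbertBasis κ ℂ W) (ω : W →L[ℂ] W) (b : H →L[ℂ] H) : Prop :=
  ∀ (X : H →L[ℂ] H) (Z : W →L[ℂ] W), IsTensorOp T X 1 Z →
    trC eH (b ∘L X) = trC eW (ω ∘L Z)

/-- `c = Tr_H ω`, the right partial trace, characterized by duality. -/
def IsRightMarginal (T : TensorStruct H K W) {ι κ : Type*} (eK : HilbertBasis ι ℂ K)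
    (eW : HilbertBasis κ ℂ W) (ω : W →L[ℂ] W) (c : K →L[ℂ] K) : Prop :=
  ∀ (Y : K →L[ℂ] K) (Z : W →L[ℂ] W), IsTensorOp T 1 Y Z →
    trC eK (c ∘L Y) = trC eW (ω ∘L Z)

end Tensor

section TraceClass

variable {H K : Type*} [NormedAddCommGroup H] [InnerProductSpace ℂ H]
  [NormedAddCommGroup K] [InnerProductSpace ℂ K]

@[simp]
lemma rankOne_apply_eq (y : K) (z x : H) : rankOne y z x = ⟪z, x⟫ • y := by
  simp [rankOne]

/-- `A = ∑ₙ |f n⟩⟨g n|` is a nuclear representation of `A`. -/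
structure IsNuclearRep (f : ℕ → K) (g : ℕ → H) (A : H →L[ℂ] K) : Prop where
  summable : Summable fun n => ‖f n‖ * ‖g n‖
  hasSum : ∀ x, HasSum (fun n => ⟪g n, x⟫ • f n) (A x)

lemma isTC_iff {A : H →L[ℂ] K} : IsTC A ↔ ∃ f g, IsNuclearRep f g A :=
  ⟨fun ⟨f, g, h₁, h₂⟩ => ⟨f, g, h₁, h₂⟩, fun ⟨f, g, h⟩ => ⟨f, g, h.1, h.2⟩⟩

namespace IsNuclearRep

variable {f : ℕ → K} {g : ℕ → H} {A : H →L[ℂ] K}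

lemma isTC (h : IsNuclearRep f g A) : IsTC A := isTC_iff.2 ⟨f, g, h⟩

lemma comp_left {L : Type*} [NormedAddCommGroup L] [InnerProductSpace ℂ L]
    (h : IsNuclearRep f g A) (B : K →L[ℂ] L) :
    IsNuclearRep (fun n => B (f n)) g (B ∘L A) where
  summable := by
    refine (h.summable.mul_left ‖B‖).of_nonneg_of_le (fun n => by positivity) fun n => ?_
    rw [← mul_assoc]
    gcongr
    exact B.le_opNorm _
  hasSum x := by simpa using (h.hasSum x).mapL B

lemma smul (h : IsNuclearRep f g A) (c : ℂ) : IsNuclearRep (fun n => c • f n) g (c • A) where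
  summable := by simpa [norm_smul, mul_assoc] using h.summable.mul_left ‖c‖
  hasSum x := by simpa [smul_comm c] using (h.hasSum x).const_smul c

/-- The trace of `∑ₙ |f n⟩⟨g n|` is `∑ₙ ⟨g n, f n⟩`. -/
lemma hasSum_trC {ι : Type*} (e : HilbertBasis ι ℂ H) {f g : ℕ → H} {A : H →L[ℂ] H}
    (h : IsNuclearRep f g A) :
    HasSum (fun i => ⟪e i, A (e i)⟫) (∑' n, ⟪g n, f n⟫) := by
  have bound (x y : H) : Summable (fun i => ‖⟪x, e i⟫ * ⟪e i, y⟫‖) ∧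
      ∑' i, ‖⟪x, e i⟫ * ⟪e i, y⟫‖ ≤ ‖x‖ * ‖y‖ := by
    have sq (z : H) : HasSum (fun i => ‖⟪e i, z⟫‖ ^ (2 : ℝ)) (‖z‖ ^ (2 : ℝ)) := by
      have := (e.hasSum_inner_mul_inner z z).mapL Complex.reCLM
      rw [inner_self_eq_norm_sq_to_K] at this
      convert! this using 2 with i
      · rw [← inner_conj_symm z, RCLike.conj_mul]
        simp [← Complex.ofReal_pow]
      · simp [← Complex.ofReal_pow]
    have := Real.inner_le_Lp_mul_Lq_hasSum_of_nonneg Real.HolderConjugate.two_two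
      (f := fun i => ‖⟪e i, x⟫‖) (g := fun i => ‖⟪e i, y⟫‖) (norm_nonneg x) (norm_nonneg y)
      (fun _ => norm_nonneg _) (fun _ => norm_nonneg _) (sq x) (sq y)
    obtain ⟨C, -, hC, hs⟩ := this
    simp_rw [norm_mul, norm_inner_symm x]
    exact ⟨hs.summable, hs.tsum_eq.trans_le hC⟩
  have key : Summable fun p : ℕ × ι => ⟪g p.1, e p.2⟫ * ⟪e p.2, f p.1⟫ := by
    rw [← summable_norm_iff, summable_prod_of_nonneg fun _ => norm_nonneg _]
    refine ⟨fun n => (bound (g n) (f n)).1, ?_⟩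
    refine h.summable.of_nonneg_of_le (fun _ => tsum_nonneg fun _ => norm_nonneg _) fun n => ?_
    exact (bound (g n) (f n)).2.trans_eq (mul_comm _ _)
  obtain ⟨S, hS⟩ := key
  have h₁ : HasSum (fun n => ⟪g n, f n⟫) S :=
    HasSum.prod_fiberwise hS fun n => e.hasSum_inner_mul_inner (g n) (f n)
  have h₂ : HasSum (fun p : ι × ℕ => ⟪g p.2, e p.1⟫ * ⟪e p.1, f p.2⟫) S :=
    (Equiv.prodComm ι ℕ).hasSum_iff.2 hS
  rw [h₁.tsum_eq]
  refine h₂.prod_fiberwise fun i => ?_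
  simpa [inner_smul_right] using (h.hasSum (e i)).mapL (innerSL ℂ (e i))

lemma trC_eq {ι : Type*} (e : HilbertBasis ι ℂ H) {f g : ℕ → H} {A : H →L[ℂ] H}
    (h : IsNuclearRep f g A) : trC e A = ∑' n, ⟪g n, f n⟫ :=
  (h.hasSum_trC e).tsum_eq

lemma norm_trC_comp_le {ι : Type*} (e : HilbertBasis ι ℂ H) {f g : ℕ → H} {A : H →L[ℂ] H}
    (h : IsNuclearRep f g A) (B : H →L[ℂ] H) (hB : ‖B‖ ≤ 1) :
    ‖trC e (B ∘L A)‖ ≤ ∑' n, ‖f n‖ * ‖g n‖ := by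
  rw [(h.comp_left B).trC_eq e]
  refine tsum_of_norm_bounded h.summable.hasSum fun n => ?_
  calc ‖⟪g n, B (f n)⟫‖ ≤ ‖g n‖ * ‖B (f n)‖ := norm_inner_le_norm _ _
    _ ≤ ‖g n‖ * ‖f n‖ := by gcongr; simpa using B.le_of_opNorm_le hB (f n)
    _ = _ := mul_comm _ _

lemma trC_rankOne_comp {ι : Type*} (e : HilbertBasis ι ℂ H) {f g : ℕ → H} {A : H →L[ℂ] H}
    (h : IsNuclearRep f g A) (x y : H) : trC e (rankOne y x ∘L A) = ⟪x, A y⟫ := by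
  rw [(h.comp_left _).trC_eq e]
  refine HasSum.tsum_eq ?_
  simpa [inner_smul_right, mul_comm] using (h.hasSum y).mapL (innerSL ℂ x)

end IsNuclearRep

lemma IsTC.smul {A : H →L[ℂ] K} (hA : IsTC A) (c : ℂ) : IsTC (c • A) := by
  obtain ⟨f, g, h⟩ := isTC_iff.1 hA
  exact (h.smul c).isTC

lemma IsTC.add {A B : H →L[ℂ] K} (hA : IsTC A) (hB : IsTC B) : IsTC (A + B) := by
  obtain ⟨f, g, h⟩ := isTC_iff.1 hA
  obtain ⟨f', g', h'⟩ := isTC_iff.1 hB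
  obtain ⟨e⟩ : Nonempty (ℕ ⊕ ℕ ≃ ℕ) := ⟨Equiv.natSumNatEquivNat⟩
  refine ⟨Sum.elim f f' ∘ e.symm, Sum.elim g g' ∘ e.symm, ?_, fun x => ?_⟩
  · refine (e.symm.summable_iff (f := fun s => ‖Sum.elim f f' s‖ * ‖Sum.elim g g' s‖)).2 ?_
    exact (HasSum.sum (f := fun s => ‖Sum.elim f f' s‖ * ‖Sum.elim g g' s‖)
      h.summable.hasSum h'.summable.hasSum).summable
  · refine (e.symm.hasSum_iff (f := fun s => ⟪Sum.elim g g' s, x⟫ • Sum.elim f f' s)).2 ?_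
    exact HasSum.sum (f := fun s => ⟪Sum.elim g g' s, x⟫ • Sum.elim f f' s) (h.hasSum x) (h'.hasSum x)

lemma isTC_rankOne (y : K) (z : H) : IsTC (rankOne y z) := by
  refine ⟨Pi.single 0 y, Pi.single 0 z, summable_of_ne_finset_zero (s := {0}) ?_, fun x => ?_⟩
  · intro n hn
    simp [Pi.single_eq_of_ne (Finset.notMem_singleton.1 hn)]
  · convert hasSum_single 0 fun n hn => ?_
    · simp
    · simp [Pi.single_eq_of_ne hn]

/-- Trace-norm smallness controls matrix elements. -/
lemma norm_inner_sub_le_tnorm {ι : Type*} (e : HilbertBasis ι ℂ H) {X Y : H →L[ℂ] H}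
    (hX : IsTC X) (hY : IsTC Y) (x y : H) :
    ‖⟪x, X y⟫ - ⟪x, Y y⟫‖ ≤ ‖x‖ * ‖y‖ * tnorm e (X - Y) := by
  have hsub : IsTC (X - Y) := by
    simpa [sub_eq_add_neg] using hX.add (hY.smul (-1))
  obtain ⟨f, g, h⟩ := isTC_iff.1 hsub
  rcases eq_or_ne x 0 with rfl | hx
  · simp
  rcases eq_or_ne y 0 with rfl | hy
  · simp
  rw [← inner_sub_right, ← sub_apply]
  set c : ℂ := ((‖x‖ * ‖y‖ : ℝ) : ℂ) with hc
  have hc0 : c ≠ 0 := by simp [hc, hx, hy]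
  have hle : ‖rankOne (c⁻¹ • y) x‖ ≤ 1 := by
    refine opNorm_le_bound _ zero_le_one fun z => ?_
    have := norm_inner_le_norm (𝕜 := ℂ) x z
    have hx' := norm_pos_iff.2 hx
    have hy' := norm_pos_iff.2 hy
    simp only [rankOne_apply_eq, norm_smul, norm_inv, hc, Complex.norm_real, norm_mul, norm_norm]
    calc _ ≤ (‖x‖ * ‖z‖) * ((‖x‖ * ‖y‖)⁻¹ * ‖y‖) := by gcongr
      _ = 1 * ‖z‖ := by field_simp
  have := le_csSup (a := ‖trC e (rankOne (c⁻¹ • y) x ∘L (X - Y))‖)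
    (s := {r : ℝ | ∃ B : H →L[ℂ] H, ‖B‖ ≤ 1 ∧ r = ‖trC e (B ∘L (X - Y))‖})
    ⟨_, fun r ⟨B, hB, hr⟩ => hr ▸ h.norm_trC_comp_le e B hB⟩ ⟨_, hle, rfl⟩
  rw [h.trC_rankOne_comp, map_smul, inner_smul_right, norm_mul, norm_inv] at this
  rw [← inv_mul_le_iff₀ (by positivity)]
  simpa only [hc, Complex.norm_real, norm_mul, norm_norm, tnorm] using this

lemma TNConv.tendsto_inner {ι : Type*} {e : HilbertBasis ι ℂ H} {a : ℕ → H →L[ℂ] H}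
    {L : H →L[ℂ] H} (h : TNConv e a L) (ha : ∀ n, IsTC (a n)) (hL : IsTC L) (x y : H) :
    Tendsto (fun n => ⟪x, a n y⟫) atTop (𝓝 ⟪x, L y⟫) := by
  rw [tendsto_iff_norm_sub_tendsto_zero]
  refine squeeze_zero (fun _ => norm_nonneg _)
    (fun n => norm_inner_sub_le_tnorm e (ha n) hL x y) ?_
  simpa using Tendsto.const_mul (‖x‖ * ‖y‖) h

lemma hasSum_trC_rankOne {ι : Type*} (e : HilbertBasis ι ℂ H) (x y : H) :
    HasSum (fun i => ⟪e i, rankOne x y (e i)⟫) ⟪y, x⟫ := by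
  simpa [inner_smul_right] using e.hasSum_inner_mul_inner y x

/-- The trace of `∑ᵢ |v i⟩⟨v i|`. -/
lemma trC_sum_rankOne_self {ι κ : Type*} [Fintype κ] (e : HilbertBasis ι ℂ H) (v : κ → H) :
    trC e (∑ k, rankOne (v k) (v k)) = ((∑ k, ‖v k‖ ^ 2 : ℝ) : ℂ) := by
  refine HasSum.tsum_eq ?_
  have := hasSum_sum (s := Finset.univ) fun k _ => hasSum_trC_rankOne e (v k) (v k)
  simpa [inner_self_eq_norm_sq_to_K, inner_sum, sum_apply] using this

lemma comp_rankOne_comp_adjoint [CompleteSpace H] [CompleteSpace K] (A : H →L[ℂ] K) (x : H) :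
    A ∘L rankOne x x ∘L adjoint A = rankOne (A x) (A x) := by
  ext z
  simp [adjoint_inner_right]

end TraceClass

section Polarization

variable {H : Type*} [NormedAddCommGroup H] [InnerProductSpace ℂ H]

lemma norm_rankOne_le (y z : H) : ‖rankOne y z‖ ≤ ‖y‖ * ‖z‖ := by
  refine opNorm_le_bound _ (by positivity) fun x => ?_
  rw [rankOne_apply_eq, norm_smul]
  calc _ ≤ (‖z‖ * ‖x‖) * ‖y‖ := by gcongr; exact norm_inner_le_norm _ _
    _ = _ := by ring

lemma exists_isNuclearRep_self [CompleteSpace H] {h : ℕ → H}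
    (hh : Summable fun n => ‖h n‖ * ‖h n‖) :
    ∃ ρ, IsNuclearRep h h ρ := by
  have hs : Summable fun n => rankOne (h n) (h n) :=
    .of_norm_bounded hh fun n => norm_rankOne_le _ _
  exact ⟨_, hh, fun x => by simpa using hs.hasSum.mapL (apply ℂ H x)⟩

namespace IsNuclearRep

lemma isPositive_of_self {h : ℕ → H} {ρ : H →L[ℂ] H} (hρ : IsNuclearRep h h ρ) :
    ρ.IsPositive := by
  rw [isPositive_iff_complex]
  intro x
  have hs : HasSum (fun n => ((‖⟪h n, x⟫‖ ^ 2 : ℝ) : ℂ)) ⟪ρ x, x⟫ := by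
    have := ((hρ.hasSum x).mapL (innerSL ℂ x)).star
    simp only [innerSL_apply_apply, inner_smul_right, RCLike.star_def, map_mul,
      inner_conj_symm] at this
    convert! this using 2 with n
    rw [← inner_conj_symm x, RCLike.conj_mul]
    simp
  rw [← hs.tsum_eq, ← Complex.ofReal_tsum]
  exact ⟨by simp, by simpa using tsum_nonneg fun n => sq_nonneg ‖⟪h n, x⟫‖⟩

lemma trC_of_self {ι : Type*} (e : HilbertBasis ι ℂ H) {h : ℕ → H} {ρ : H →L[ℂ] H}
    (hρ : IsNuclearRep h h ρ) : trC e ρ = ((∑' n, ‖h n‖ ^ 2 : ℝ) : ℂ) := by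
  simp [hρ.trC_eq e, inner_self_eq_norm_sq_to_K, Complex.ofReal_tsum]

/-- Every nuclear representation can be balanced. -/
lemma exists_balanced {f g : ℕ → H} {ρ : H →L[ℂ] H} (hρ : IsNuclearRep f g ρ) :
    ∃ f' g', IsNuclearRep f' g' ρ ∧ (Summable fun n => ‖f' n‖ ^ 2) ∧
      Summable fun n => ‖g' n‖ ^ 2 := by
  set c : ℕ → ℝ := fun n => √(‖f n‖ * ‖g n‖)
  have hc (n : ℕ) : c n * c n = ‖f n‖ * ‖g n‖ := Real.mul_self_sqrt (by positivity)
  have hle (u : ℕ → H) (n : ℕ) : ‖((c n / ‖u n‖ : ℝ) : ℂ) • u n‖ ^ 2 ≤ ‖f n‖ * ‖g n‖ := by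
    rw [norm_smul, Complex.norm_real, mul_pow, Real.norm_eq_abs, sq_abs]
    rcases eq_or_ne (u n) 0 with h | h
    · simp [h]; positivity
    · rw [div_pow, div_mul_cancel₀ _ (by simpa using h), sq, hc]
  have hsum (u : ℕ → H) : Summable fun n => ‖((c n / ‖u n‖ : ℝ) : ℂ) • u n‖ ^ 2 :=
    hρ.summable.of_nonneg_of_le (fun _ => by positivity) (hle u)
  refine ⟨fun n => ((c n / ‖f n‖ : ℝ) : ℂ) • f n, fun n => ((c n / ‖g n‖ : ℝ) : ℂ) • g n,
    ⟨?_, fun x => ?_⟩, hsum f, hsum g⟩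
  · refine ((hsum f).add (hsum g)).of_nonneg_of_le (fun _ => by positivity) fun n => ?_
    nlinarith [sq_nonneg (‖((c n / ‖f n‖ : ℝ) : ℂ) • f n‖ - ‖((c n / ‖g n‖ : ℝ) : ℂ) • g n‖),
      sq_nonneg (‖((c n / ‖f n‖ : ℝ) : ℂ) • f n‖), sq_nonneg (‖((c n / ‖g n‖ : ℝ) : ℂ) • g n‖)]
  · convert! hρ.hasSum x using 2 with n
    rw [inner_smul_left, Complex.conj_ofReal, smul_smul]
    rcases eq_or_ne (f n) 0 with hf | hf
    · simp [hf]
    rcases eq_or_ne (g n) 0 with hg | hg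
    · simp [hg]
    congr 1
    rw [mul_right_comm, ← Complex.ofReal_mul, div_mul_div_comm, hc, mul_comm ‖g n‖,
      div_self (by simp [hf, hg])]
    simp

end IsNuclearRep

/-- Trace-class operators are spanned by the positive operators `∑ₙ |h n⟩⟨h n|`. -/
lemma IsTC.induction [CompleteSpace H] {P : (H →L[ℂ] H) → Prop}
    (self : ∀ (h : ℕ → H) (ρ : H →L[ℂ] H), IsNuclearRep h h ρ → P ρ)
    (hadd : ∀ ρ σ, IsTC ρ → IsTC σ → P ρ → P σ → P (ρ + σ))
    (smul : ∀ (c : ℂ) ρ, IsTC ρ → P ρ → P (c • ρ))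
    {ρ : H →L[ℂ] H} (hρ : IsTC ρ) : P ρ := by
  obtain ⟨f₀, g₀, h₀⟩ := isTC_iff.1 hρ
  obtain ⟨f, g, h, hf, hg⟩ := h₀.exists_balanced
  have hex (c : ℂ) : ∃ σ, IsNuclearRep (fun n => f n + c • g n) (fun n => f n + c • g n) σ := by
    refine exists_isNuclearRep_self ?_
    refine ((hf.mul_left 2).add (hg.mul_left (2 * ‖c‖ ^ 2))).of_nonneg_of_le
      (fun _ => by positivity) fun n => ?_
    have := norm_add_le (f n) (c • g n)
    rw [norm_smul] at this
    nlinarith [norm_nonneg (f n + c • g n), sq_nonneg (‖f n‖ - ‖c‖ * ‖g n‖)]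
  choose σ hσ using hex
  have hP (c d : ℂ) : P (c • σ d) ∧ IsTC (c • σ d) :=
    ⟨smul _ _ (hσ d).isTC (self _ _ (hσ d)), (hσ d).isTC.smul c⟩
  have hPadd {A B : H →L[ℂ] H} (hA : P A ∧ IsTC A) (hB : P B ∧ IsTC B) :
      P (A + B) ∧ IsTC (A + B) := ⟨hadd _ _ hA.2 hB.2 hA.1 hB.1, hA.2.add hB.2⟩
  have hdecomp : ρ = (1 / 4 : ℂ) • σ 1 + (Complex.I / 4) • σ Complex.I +
      (-1 / 4 : ℂ) • σ (-1) + (-Complex.I / 4) • σ (-Complex.I) := by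
    ext x
    refine (h.hasSum x).unique ?_
    have key (c d : ℂ) := ((hσ c).hasSum x).const_smul d
    refine ((((key 1 (1 / 4)).add (key Complex.I (Complex.I / 4))).add
      (key (-1) (-1 / 4))).add (key (-Complex.I) (-Complex.I / 4))).congr_fun
      fun n => ?_
    simp only [inner_add_left, inner_smul_left, map_neg, map_one, Complex.conj_I]
    match_scalars <;> ring_nf <;> simp only [Complex.I_sq] <;> ring
  rw [hdecomp]
  exact (hPadd (hPadd (hPadd (hP _ _) (hP _ _)) (hP _ _)) (hP _ _)).1

end Polarization

section WeakLimits

variable {α H K : Type*} [NormedAddCommGroup H] [InnerProductSpace ℂ H]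
  [NormedAddCommGroup K] [InnerProductSpace ℂ K]

lemma Ultrafilter.exists_weak_limit [CompleteSpace K] (U : Ultrafilter α) {u : α → K} {C : ℝ}
    (hu : ∀ n, ‖u n‖ ≤ C) :
    ∃ ψ : K, ‖ψ‖ ≤ C ∧ ∀ y, Tendsto (fun n => ⟪u n, y⟫) U (𝓝 ⟪ψ, y⟫) := by
  let v : α → WeakDual ℂ K := fun n => StrongDual.toWeakDual (InnerProductSpace.toDual ℂ K (u n))
  obtain ⟨φ, hφ, hlim⟩ := (WeakDual.isCompact_closedBall (𝕜 := ℂ) (E := K) 0 C).ultrafilter_le_nhds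
    (U.map v) (by
      refine le_principal_iff.2 (Ultrafilter.mem_map.2 (Filter.univ_mem' fun n => ?_))
      simpa [v] using hu n)
  refine ⟨(InnerProductSpace.toDual ℂ K).symm (WeakDual.toStrongDual φ), by simpa using hφ,
    fun y => ?_⟩
  have : Tendsto v U (𝓝 φ) := hlim
  simpa [v, Function.comp_def] using ((WeakDual.eval_continuous y).tendsto φ).comp this

/-- Contractions have limits along ultrafilters in the weak operator topology. -/
lemma Ultrafilter.exists_weakOperator_limit [CompleteSpace K] (U : Ultrafilter α)
    {A : α → H →L[ℂ] K}
    (hA : ∀ n x, ‖A n x‖ ≤ ‖x‖) :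
    ∃ A₀ : H →L[ℂ] K, ∀ x y, Tendsto (fun n => ⟪A n x, y⟫) U (𝓝 ⟪A₀ x, y⟫) := by
  choose ψ hψ hlim using fun x => U.exists_weak_limit fun n => hA n x
  let L : H →ₗ[ℂ] K :=
    { toFun := ψ
      map_add' := fun x x' => ext_inner_right ℂ fun y => by
        refine tendsto_nhds_unique (hlim (x + x') y) ?_
        simpa [inner_add_left] using (hlim x y).add (hlim x' y)
      map_smul' := fun c x => ext_inner_right ℂ fun y => by
        refine tendsto_nhds_unique (hlim (c • x) y) ?_
        simpa [inner_smul_left, mul_comm] using (hlim x y).const_mul (starRingEnd ℂ c) }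
  exact ⟨L.mkContinuous 1 fun x => by simpa [L] using hψ x, hlim⟩

/-- Weak convergence of contractions `A n` implies weak convergence of `A n ρ (A n)†` for
trace-class `ρ`. -/
lemma IsTC.tendsto_inner_conj [CompleteSpace H] [CompleteSpace K] {l : Filter α}
    {ρ : H →L[ℂ] H} (hρ : IsTC ρ) {A : α → H →L[ℂ] K} {A₀ : H →L[ℂ] K} (hA : ∀ n x, ‖A n x‖ ≤ ‖x‖)
    (hlim : ∀ x y, Tendsto (fun n => ⟪A n x, y⟫) l (𝓝 ⟪A₀ x, y⟫)) (x y : K) :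
    Tendsto (fun n => ⟪x, (A n ∘L ρ ∘L adjoint (A n)) y⟫) l
      (𝓝 ⟪x, (A₀ ∘L ρ ∘L adjoint A₀) y⟫) := by
  obtain ⟨f, g, h⟩ := isTC_iff.1 hρ
  have expand (B : H →L[ℂ] K) :
      ⟪x, (B ∘L ρ ∘L adjoint B) y⟫ = ∑' k, ⟪B (g k), y⟫ * ⟪x, B (f k)⟫ := by
    refine (HasSum.tsum_eq ?_).symm
    simpa [inner_smul_right, adjoint_inner_right] using
      ((h.hasSum (adjoint B y)).mapL B).mapL (innerSL ℂ x)
  simp_rw [expand]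
  refine tendsto_tsum_of_dominated_convergence (h.summable.mul_left (‖x‖ * ‖y‖))
    (fun k => (hlim (g k) y).mul ?_) (Eventually.of_forall fun n k => ?_)
  · simpa [Function.comp_def] using (Complex.continuous_conj.tendsto _).comp (hlim (f k) x)
  · calc ‖⟪A n (g k), y⟫ * ⟪x, A n (f k)⟫‖
        ≤ (‖A n (g k)‖ * ‖y‖) * (‖x‖ * ‖A n (f k)‖) := by
          rw [norm_mul]
          gcongr <;> exact norm_inner_le_norm _ _
      _ ≤ (‖g k‖ * ‖y‖) * (‖x‖ * ‖f k‖) := by gcongr <;> exact hA _ _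
      _ = _ := by ring

/-- Weak convergence together with convergence of the norms implies strong convergence, for
finite families of vectors. -/
lemma tendsto_of_tendsto_inner_of_tendsto_sum_norm_sq {κ : Type*} [Fintype κ] {l : Filter α}
    {u : α → κ → K} {v : κ → K}
    (hw : ∀ i y, Tendsto (fun n => ⟪u n i, y⟫) l (𝓝 ⟪v i, y⟫))
    (hn : Tendsto (fun n => ∑ i, ‖u n i‖ ^ 2) l (𝓝 (∑ i, ‖v i‖ ^ 2))) (i : κ) :
    Tendsto (fun n => u n i) l (𝓝 (v i)) := by
  have hsum : Tendsto (fun n => ∑ i, ‖u n i - v i‖ ^ 2) l (𝓝 0) := by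
    have h₁ : Tendsto (fun n => ∑ i, RCLike.re ⟪u n i, v i⟫) l (𝓝 (∑ i, ‖v i‖ ^ 2)) := by
      refine tendsto_finsetSum _ fun i _ => ?_
      rw [← inner_self_eq_norm_sq (𝕜 := ℂ)]
      exact (RCLike.continuous_re.tendsto _).comp (hw i (v i))
    have := (hn.sub (h₁.const_mul 2)).add_const (∑ i, ‖v i‖ ^ 2)
    convert! this using 2 with n
    · simp only [@norm_sub_sq ℂ, Finset.sum_add_distrib, Finset.sum_sub_distrib, Finset.mul_sum]
    · ring
  rw [tendsto_iff_norm_sub_tendsto_zero]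
  have hsq : Tendsto (fun n => ‖u n i - v i‖ ^ 2) l (𝓝 0) :=
    squeeze_zero (fun _ => by positivity) (fun n => Finset.single_le_sum
      (f := fun i => ‖u n i - v i‖ ^ 2) (fun _ _ => by positivity) (Finset.mem_univ i)) hsum
  simpa using hsq.sqrt

end WeakLimits

section Channel

variable {H K : Type*} [NormedAddCommGroup H] [InnerProductSpace ℂ H] [CompleteSpace H]
  [NormedAddCommGroup K] [InnerProductSpace ℂ K] [CompleteSpace K]
  {eA : HilbertBasis ℕ ℂ H} {eB : HilbertBasis ℕ ℂ K}

/-- Trace preservation in Kraus form: `∑ᵢ (A i)† (A i) = 1`. -/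
lemma IsChannel.sum_norm_sq {κ : Type*} [Fintype κ] {Φ : QOp eA eB} (hΦ : IsChannel Φ)
    {A : κ → H →L[ℂ] K}
    (hA : ∀ ρ : H →L[ℂ] H, IsTC ρ → Φ.toFun ρ = ∑ i, A i ∘L ρ ∘L adjoint (A i)) (x : H) :
    ∑ i, ‖A i x‖ ^ 2 = ‖x‖ ^ 2 := by
  have hpos : (rankOne x x).IsPositive := by
    convert InnerProductSpace.isPositive_rankOne_self (𝕜 := ℂ) x
    ext z
    simp
  have h := hΦ _ hpos (isTC_rankOne x x)
  rw [hA _ (isTC_rankOne x x)] at h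
  simp_rw [comp_rankOne_comp_adjoint] at h
  rw [trC_sum_rankOne_self] at h
  have h' := trC_sum_rankOne_self eA fun _ : Unit => x
  simp only [Finset.univ_unique, Finset.sum_const, Finset.card_singleton, one_smul] at h'
  exact_mod_cast h.trans h'

/-- A quantum operation agrees with a Kraus form on trace-class operators as soon as it does so on
states. -/
lemma QOp.eq_kraus_of_state {κ : Type*} [Fintype κ] (Φ : QOp eA eB) {A : κ → H →L[ℂ] K}
    (hA : ∀ ρ : H →L[ℂ] H, IsState eA ρ → Φ.toFun ρ = ∑ i, A i ∘L ρ ∘L adjoint (A i))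
    {ρ : H →L[ℂ] H} (hρ : IsTC ρ) : Φ.toFun ρ = ∑ i, A i ∘L ρ ∘L adjoint (A i) := by
  have smul (c : ℂ) (ρ : H →L[ℂ] H) (hρ : IsTC ρ)
      (h : Φ.toFun ρ = ∑ i, A i ∘L ρ ∘L adjoint (A i)) :
      Φ.toFun (c • ρ) = ∑ i, A i ∘L (c • ρ) ∘L adjoint (A i) := by
    simp [Φ.map_smul' c ρ hρ, h, Finset.smul_sum]
  refine IsTC.induction (fun h ρ hρ => ?_) (fun ρ σ hρ hσ h₁ h₂ => ?_) smul hρ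
  · set t : ℝ := ∑' n, ‖h n‖ ^ 2
    have htr : trC eA ρ = t := hρ.trC_of_self eA
    have hsum : Summable fun n => ‖h n‖ ^ 2 := by simpa [sq] using hρ.summable
    have ht0 : 0 ≤ t := tsum_nonneg fun _ => by positivity
    rcases ht0.eq_or_lt with ht | ht
    · have hz : ρ = 0 := by
        have h0 : ∀ n, h n = 0 := by
          have := (hasSum_zero_iff_of_nonneg fun n => sq_nonneg ‖h n‖).1 (by rw [ht]; exact hsum.hasSum)
          exact fun n => by simpa using congrFun this n
        ext x
        simpa [h0] using (hρ.hasSum x).tsum_eq.symm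
      simpa [hz] using Φ.map_smul' 0 ρ hρ.isTC
    · have hc : ((t⁻¹ : ℝ) : ℂ) * t = 1 := by
        rw [← Complex.ofReal_mul, inv_mul_cancel₀ ht.ne', Complex.ofReal_one]
      have hst : IsState eA (((t⁻¹ : ℝ) : ℂ) • ρ) := by
        refine ⟨hρ.isPositive_of_self.smul_of_nonneg (by exact_mod_cast inv_nonneg.2 ht0),
          hρ.isTC.smul _, ?_⟩
        rw [← hc, ← htr]
        simp only [trC, smul_apply, inner_smul_right, tsum_mul_left]
      have := smul t _ hst.2.1 (hA _ hst)
      rwa [smul_smul, mul_comm, hc, one_smul] at this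
  · simp [Φ.map_add' ρ σ hρ hσ, h₁, h₂, Finset.sum_add_distrib]

end Channel

/-- Strong convergence of contractions can be tested on a Hilbert basis. -/
lemma HilbertBasis.tendsto_apply_of_tendsto_basis {ι α H K : Type*} [NormedAddCommGroup H]
    [InnerProductSpace ℂ H] [NormedAddCommGroup K] [InnerProductSpace ℂ K]
    (e : HilbertBasis ι ℂ H) {l : Filter α} {A : α → H →L[ℂ] K} {A₀ : H →L[ℂ] K}
    (hA : ∀ n x, ‖A n x‖ ≤ ‖x‖) (h : ∀ i, Tendsto (fun n => A n (e i)) l (𝓝 (A₀ (e i))))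
    (x : H) : Tendsto (fun n => A n x) l (𝓝 (A₀ x)) := by
  have heq : Equicontinuous fun n => (A n : H → K) := by
    refine (LipschitzWith.uniformEquicontinuous _ 1 fun n => ?_).equicontinuous
    exact (A n).lipschitz.weaken (by
      rw [← NNReal.coe_le_coe]
      exact (A n).opNorm_le_bound zero_le_one fun x => by simpa using hA n x)
  have hcl := heq.isClosed_setOfPred_tendsto (l := l) A₀.continuous
  have hspan : (Submodule.span ℂ (Set.range e) : Set H) ⊆
      {x | Tendsto (fun n => A n x) l (𝓝 (A₀ x))} := by
    intro y hy
    induction hy using Submodule.span_induction with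
    | mem y hy => obtain ⟨i, rfl⟩ := hy; exact h i
    | zero => simpa using tendsto_const_nhds
    | add y z _ _ hy hz => simpa using Tendsto.add hy hz
    | smul c y _ hy => simpa using Tendsto.const_smul hy c
  have hmem : x ∈ closure (Submodule.span ℂ (Set.range e) : Set H) := by
    rw [← Submodule.topologicalClosure_coe, e.dense_span]
    trivial
  exact closure_minimal hspan hcl hmem

section Statement

variable {HA HB : Type*} [NormedAddCommGroup HA] [InnerProductSpace ℂ HA] [CompleteSpace HA]
  [NormedAddCommGroup HB] [InnerProductSpace ℂ HB] [CompleteSpace HB]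

/-- From any sequence of Kraus representations (with `m` Kraus operators) of a strongly
converging sequence of quantum channels with Choi rank `≤ m` one can extract a subsequence
converging (in the strong operator topology) to a Kraus representation of the limit channel. -/
theorem Kraus_representations_converge
    (eA : HilbertBasis ℕ ℂ HA) (eB : HilbertBasis ℕ ℂ HB)
    (m : ℕ) (Φn : ℕ → QOp eA eB) (Φ₀ : QOp eA eB)
    (hch : ∀ n, IsChannel (Φn n)) (h₀ : IsChannel Φ₀)
    (hconv : StrongConv Φn Φ₀)
    (hCh : ∀ n, ChoiRank (Φn n) ≤ (m : ℕ∞))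
    (A : ℕ → Fin m → HA →L[ℂ] HB)
    (hK : ∀ (n : ℕ) (ρ : HA →L[ℂ] HA), IsTC ρ →
      (Φn n).toFun ρ = ∑ i, A n i ∘L ρ ∘L ContinuousLinearMap.adjoint (A n i)) :
    ∃ (A₀ : Fin m → HA →L[ℂ] HB) (k : ℕ → ℕ), StrictMono k ∧
      (∀ i, SOTConv (fun j => A (k j) i) (A₀ i)) ∧
      ∀ ρ : HA →L[ℂ] HA, IsTC ρ →
        Φ₀.toFun ρ = ∑ i, A₀ i ∘L ρ ∘L ContinuousLinearMap.adjoint (A₀ i) := by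
  have hsq n x := (hch n).sum_norm_sq (hK n) x
  have hA n i x : ‖A n i x‖ ≤ ‖x‖ := by
    refine (sq_le_sq₀ (norm_nonneg _) (norm_nonneg x)).1 ?_
    rw [← hsq n x]
    exact Finset.single_le_sum (f := fun i => ‖A n i x‖ ^ 2) (fun _ _ => by positivity)
      (Finset.mem_univ i)
  set U : Ultrafilter ℕ := hyperfilter ℕ
  have hU : (U : Filter ℕ) ≤ atTop := Nat.hyperfilter_le_atTop
  choose A₀ hlim using fun i => U.exists_weakOperator_limit fun n x => hA n i x
  have hK₀ : ∀ ρ : HA →L[ℂ] HA, IsTC ρ →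
      Φ₀.toFun ρ = ∑ i, A₀ i ∘L ρ ∘L ContinuousLinearMap.adjoint (A₀ i) := by
    refine fun ρ hρ => Φ₀.eq_kraus_of_state (fun ρ hρ => ?_) hρ
    refine ContinuousLinearMap.ext fun y => ext_inner_left ℂ fun x => ?_
    have h₁ := ((hconv ρ hρ).tendsto_inner (fun n => (Φn n).maps_tc' ρ hρ.2.1)
      (Φ₀.maps_tc' ρ hρ.2.1) x y).mono_left hU
    refine tendsto_nhds_unique h₁ ?_
    simp_rw [hK _ ρ hρ.2.1, sum_apply, inner_sum]
    exact tendsto_finsetSum _ fun i _ =>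
      hρ.2.1.tendsto_inner_conj (fun n x => hA n i x) (hlim i) x y
  have hstrong i x : Tendsto (fun n => A n i x) U (𝓝 (A₀ i x)) := by
    refine tendsto_of_tendsto_inner_of_tendsto_sum_norm_sq (u := fun n i => A n i x)
      (v := fun i => A₀ i x) (fun i y => hlim i x y) ?_ i
    simp_rw [hsq, h₀.sum_norm_sq hK₀ x]
    exact tendsto_const_nhds
  have hclus : MapClusterPt (fun p : Fin m × ℕ => A₀ p.1 (eA p.2)) atTop
      fun n (p : Fin m × ℕ) => A n p.1 (eA p.2) :=
    (tendsto_pi_nhds.2 fun p : Fin m × ℕ => hstrong p.1 (eA p.2)).mapClusterPt.mono hU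
  obtain ⟨k, hk, hkt⟩ := hclus.tendsto_subseq
  refine ⟨A₀, k, hk, fun i x => ?_, hK₀⟩
  exact eA.tendsto_apply_of_tendsto_basis (l := atTop) (A := fun j => A (k j) i) (A₀ := A₀ i)
    (fun j x => hA (k j) i x) (fun p => (tendsto_pi_nhds.1 hkt) (i, p)) x

end Statement
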